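/- Fix an integer i ≥ 1 and an integer g with g > 4i + 12. Then the dimension over ℚ of the weighted-degree-i homogeneous component Q(g)_i of the graded ring Q(g) equals: 2 if i = 1; 4 if i = 2; 3 if i = 3; 2 if i = 4; and 1 if i ≥ 5. (This is the algebraic content of the dimension formulas for the stable Chow groups of the degree-4 Hurwitz space in the paper's main theorem.) -/

import Mathlib

open MvPolynomial

noncomputable section

/-- The polynomial ring `ℚ[a₁, a₂′, a₃′]`. -/
abbrev R3 : Type := MvPolynomial (Fin 3) ℚ

/-- Weights: `a₁` and `a₂′` have weight 1, `a₃′` has weight 2. -/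
def wt : Fin 3 → ℕ := ![1, 1, 2]

def a1 : R3 := X 0
def a2' : R3 := X 1
def a3' : R3 := X 2

/-- The relation `r₁`. -/
def r1 (g : ℤ) : R3 :=
  C (2*(g:ℚ)^3 + 9*(g:ℚ)^2 + 10*(g:ℚ)) * a1^3
    - C (8*(g:ℚ)^2 + 24*(g:ℚ) + 8) * (a1 * a3')

/-- The relation `r₂`. -/
def r2 (g : ℤ) : R3 :=
  C (12*(g:ℚ)^3 + 42*(g:ℚ)^2 + 36*(g:ℚ)) * (a1^2 * a2')
    - C (22*(g:ℚ)^3 + 121*(g:ℚ)^2 + 187*(g:ℚ) + 66) * (a1 * a3')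
    - C (24*(g:ℚ)^2 + 24*(g:ℚ)) * (a2' * a3')

/-- The relation `r₃`. -/
def r3 (g : ℤ) : R3 :=
  C (432*(g:ℚ)^3 + 1512*(g:ℚ)^2 + 1296*(g:ℚ)) * (a1 * a2'^2)
    - C (1450*(g:ℚ)^3 + 8001*(g:ℚ)^2 + 13115*(g:ℚ) + 5442) * (a1 * a3')
    - C (1584*(g:ℚ)^3 + 5544*(g:ℚ)^2 + 3936*(g:ℚ)) * (a2' * a3')

/-- The relation `r₄`. -/
def r4 (g : ℤ) : R3 :=
  C (14344*(g:ℚ)^6 + 165692*(g:ℚ)^5 + 747682*(g:ℚ)^4 + 1636869*(g:ℚ)^3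
      + 1719009*(g:ℚ)^2 + 677844*(g:ℚ) - 540) * (a1^2 * a3')
    - C (17280*(g:ℚ)^4 + 112320*(g:ℚ)^3 + 224640*(g:ℚ)^2 + 129600*(g:ℚ)) * (a2'^2 * a3')
    + C (352*(g:ℚ)^5 + 1440*(g:ℚ)^4 + 1448*(g:ℚ)^3 + 120*(g:ℚ)^2) * (a3'^2)

/-- The ideal `I(g) = (r₁, r₂, r₃, r₄)`. -/
def Ig (g : ℤ) : Ideal R3 := Ideal.span {r1 g, r2 g, r3 g, r4 g}

/-- The quotient map `R → Q(g) = R/I(g)`, as a `ℚ`-linear map. -/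
def Qmk (g : ℤ) : R3 →ₗ[ℚ] R3 ⧸ Ig g := (Ideal.Quotient.mkₐ ℚ (Ig g)).toLinearMap

/-- `Q(g)_i`: the image in `Q(g)` of the weighted-degree-`i` homogeneous polynomials. -/
def QComp (g : ℤ) (i : ℕ) : Submodule ℚ (R3 ⧸ Ig g) :=
  (weightedHomogeneousSubmodule ℚ wt i).map (Qmk g)

/-- The coefficients of a system of four relations expressing `a₁³`, `a₁²a₂′`, `a₁a₂′²` and
`a₁²a₃′` through the other monomials. -/
structure RelCoeffs where
  (α β γ δ ε κ μ : ℚ)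

/-- The ideal of relations with leading coefficients normalized to one. -/
def relIdeal (c : RelCoeffs) : Ideal R3 :=
  Ideal.span {a1 ^ 3 - C c.α * (a1 * a3'),
    a1 ^ 2 * a2' - C c.β * (a1 * a3') - C c.γ * (a2' * a3'),
    a1 * a2' ^ 2 - C c.δ * (a1 * a3') - C c.ε * (a2' * a3'),
    a1 ^ 2 * a3' - C c.κ * (a2' ^ 2 * a3') - C c.μ * a3' ^ 2}

/-- The weighted-degree-`i` component of the quotient by `J`. -/
abbrev component (J : Ideal R3) (i : ℕ) : Submodule ℚ (R3 ⧸ J) :=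
  (weightedHomogeneousSubmodule ℚ wt i).map (Ideal.Quotient.mkₐ ℚ J).toLinearMap

/-- The nonvanishing conditions on the coefficients which determine the Hilbert function of the
quotient; `k` is the ratio of `a₁a₂′a₃′` to `a₁²a₃′`. -/
structure RelCoeffs.Nondegenerate (c : RelCoeffs) (k : ℚ) : Prop where
  β_eq : c.β = k * (c.α - c.γ)
  sub_ne : c.α - c.γ ≠ 0
  γ_ne : c.γ ≠ 0
  κ_ne : c.κ ≠ 0
  μ_ne : c.μ ≠ 0
  disc_ne : c.δ + c.ε * k - k ^ 2 * c.α ≠ 0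

/-- The normalized coefficients of the relations `r₁, …, r₄`. -/
def hurwitzCoeffs (g : ℚ) : RelCoeffs where
  α := 8 * (g ^ 2 + 3 * g + 1) / (g * (2 * g + 5) * (g + 2))
  β := 11 * (2 * g + 1) * (g + 3) / (6 * g * (2 * g + 3))
  γ := 4 * (g + 1) / ((2 * g + 3) * (g + 2))
  δ := (1450 * g ^ 3 + 8001 * g ^ 2 + 13115 * g + 5442) / (216 * g * (2 * g + 3) * (g + 2))
  ε := (66 * g ^ 2 + 231 * g + 164) / (9 * (2 * g + 3) * (g + 2))
  κ := (17280 * g ^ 4 + 112320 * g ^ 3 + 224640 * g ^ 2 + 129600 * g) /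
    (14344 * g ^ 6 + 165692 * g ^ 5 + 747682 * g ^ 4 + 1636869 * g ^ 3
      + 1719009 * g ^ 2 + 677844 * g - 540)
  μ := -(352 * g ^ 5 + 1440 * g ^ 4 + 1448 * g ^ 3 + 120 * g ^ 2) /
    (14344 * g ^ 6 + 165692 * g ^ 5 + 747682 * g ^ 4 + 1636869 * g ^ 3
      + 1719009 * g ^ 2 + 677844 * g - 540)

lemma r4_leadingCoeff_pos {g : ℚ} (hg : 17 ≤ g) :
    0 < 14344 * g ^ 6 + 165692 * g ^ 5 + 747682 * g ^ 4 + 1636869 * g ^ 3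
      + 1719009 * g ^ 2 + 677844 * g - 540 := by
  have : 0 < g := by linarith
  have : 0 < 14344 * g ^ 6 + 165692 * g ^ 5 + 747682 * g ^ 4 + 1636869 * g ^ 3
      + 1719009 * g ^ 2 := by positivity
  linarith

lemma hurwitzCoeffs_nondegenerate {g : ℚ} (hg : 17 ≤ g) :
    (hurwitzCoeffs g).Nondegenerate (11 * (2 * g + 5) / 24) := by
  have h0 : 0 < g := by linarith
  have h4 := r4_leadingCoeff_pos hg
  have hsub : (hurwitzCoeffs g).α - (hurwitzCoeffs g).γ =
      4 * (2 * g + 1) * (g + 3) / (g * (2 * g + 5) * (2 * g + 3)) := by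
    simp only [hurwitzCoeffs]
    field_simp
    ring
  refine ⟨?_, ?_, ?_, ?_, ?_, ?_⟩
  · rw [hsub]
    simp only [hurwitzCoeffs]
    field_simp
    ring
  · rw [hsub]
    positivity
  · simp only [hurwitzCoeffs]
    positivity
  · simp only [hurwitzCoeffs]
    positivity
  · simp only [hurwitzCoeffs]
    rw [neg_div]
    exact neg_ne_zero.mpr (by positivity)
  · have : (hurwitzCoeffs g).δ + (hurwitzCoeffs g).ε * (11 * (2 * g + 5) / 24) -
        (11 * (2 * g + 5) / 24) ^ 2 * (hurwitzCoeffs g).α =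
        -((2 * g + 3) * (g + 1) ^ 2) / (216 * g * (2 * g + 3) * (g + 2)) := by
      simp only [hurwitzCoeffs]
      field_simp
      ring
    rw [this, neg_div]
    exact neg_ne_zero.mpr (by positivity)

lemma Ig_eq_relIdeal (g : ℤ) (hg : (17 : ℚ) ≤ g) : Ig g = relIdeal (hurwitzCoeffs g) := by
  have h0 : (0 : ℚ) < g := by linarith
  have h4 := r4_leadingCoeff_pos hg
  have assoc : ∀ (r s : R3) (u : ℚ), u ≠ 0 → r = C u * s →
      Ideal.span {r} = Ideal.span {s} := by
    rintro r s u hu rfl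
    exact Ideal.span_singleton_mul_left_unit ((isUnit_iff_ne_zero.mpr hu).map C) s
  unfold Ig relIdeal
  simp only [Ideal.span_insert]
  congr 1
  · have e0 : (2*(g : ℚ)^3 + 9*(g : ℚ)^2 + 10*(g : ℚ)) *
        (hurwitzCoeffs g).α = 8*(g : ℚ)^2 + 24*(g : ℚ) + 8 := by
      simp only [hurwitzCoeffs]
      field_simp
      ring
    refine assoc _ _ _ (show 2*(g : ℚ)^3 + 9*(g : ℚ)^2 + 10*(g : ℚ) ≠ 0 by positivity) ?_
    rw [r1, ← e0, C_mul]
    ring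
  congr 1
  · have e0 : (12*(g : ℚ)^3 + 42*(g : ℚ)^2 + 36*(g : ℚ)) *
        (hurwitzCoeffs g).β = 22*(g : ℚ)^3 + 121*(g : ℚ)^2 + 187*(g : ℚ) + 66 := by
      simp only [hurwitzCoeffs]
      field_simp
      ring
    have e1 : (12*(g : ℚ)^3 + 42*(g : ℚ)^2 + 36*(g : ℚ)) *
        (hurwitzCoeffs g).γ = 24*(g : ℚ)^2 + 24*(g : ℚ) := by
      simp only [hurwitzCoeffs]
      field_simp
      ring
    refine assoc _ _ _ (show 12*(g : ℚ)^3 + 42*(g : ℚ)^2 + 36*(g : ℚ) ≠ 0 by positivity) ?_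
    rw [r2, ← e0, ← e1, C_mul, C_mul]
    ring
  congr 1
  · have e0 : (432*(g : ℚ)^3 + 1512*(g : ℚ)^2 + 1296*(g : ℚ)) *
        (hurwitzCoeffs g).δ = 1450*(g : ℚ)^3 + 8001*(g : ℚ)^2 + 13115*(g : ℚ) + 5442 := by
      simp only [hurwitzCoeffs]
      field_simp
      ring
    have e1 : (432*(g : ℚ)^3 + 1512*(g : ℚ)^2 + 1296*(g : ℚ)) *
        (hurwitzCoeffs g).ε = 1584*(g : ℚ)^3 + 5544*(g : ℚ)^2 + 3936*(g : ℚ) := by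
      simp only [hurwitzCoeffs]
      field_simp
      ring
    refine assoc _ _ _ (show 432*(g : ℚ)^3 + 1512*(g : ℚ)^2 + 1296*(g : ℚ) ≠ 0 by positivity) ?_
    rw [r3, ← e0, ← e1, C_mul, C_mul]
    ring
  · have e0 : (14344*(g : ℚ)^6 + 165692*(g : ℚ)^5 + 747682*(g : ℚ)^4 + 1636869*(g : ℚ)^3
        + 1719009*(g : ℚ)^2 + 677844*(g : ℚ) - 540) *
        (hurwitzCoeffs g).κ =
        17280*(g : ℚ)^4 + 112320*(g : ℚ)^3 + 224640*(g : ℚ)^2 + 129600*(g : ℚ) := by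
      simp only [hurwitzCoeffs]
      rw [mul_div_assoc', mul_div_cancel_left₀ _ h4.ne']
    have e1 : (14344*(g : ℚ)^6 + 165692*(g : ℚ)^5 + 747682*(g : ℚ)^4 + 1636869*(g : ℚ)^3
        + 1719009*(g : ℚ)^2 + 677844*(g : ℚ) - 540) *
        (hurwitzCoeffs g).μ =
        -(352*(g : ℚ)^5 + 1440*(g : ℚ)^4 + 1448*(g : ℚ)^3 + 120*(g : ℚ)^2) := by
      simp only [hurwitzCoeffs]
      rw [mul_div_assoc', mul_div_cancel_left₀ _ h4.ne']
    refine assoc _ _ _ h4.ne' ?_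
    rw [r4, ← e0, ← neg_neg (352*(g : ℚ)^5 + _ + _ + _), ← e1, C_neg, C_mul, C_mul]
    ring

lemma monomial_eq_prod (d : Fin 3 →₀ ℕ) (r : ℚ) :
    monomial d r = C r * (a1 ^ d 0 * a2' ^ d 1 * a3' ^ d 2) := by
  rw [monomial_eq, Finsupp.prod_fintype _ _ (by simp), Fin.prod_univ_three]
  rfl

/-- The linear functional on `ℚ[a₁, a₂′, a₃′]` supported in weighted degree `n` whose value on
`a₁^p a₂′^q a₃′^s` is `t p s`. -/
def functional (n : ℕ) (t : ℕ → ℕ → ℚ) : R3 →ₗ[ℚ] ℚ :=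
  (basisMonomials (Fin 3) ℚ).constr ℚ
    fun d => if d 0 + d 1 + 2 * d 2 = n then t (d 0) (d 2) else 0

lemma functional_C_mul (n : ℕ) (t : ℕ → ℕ → ℚ) (r : ℚ) (f : R3) :
    functional n t (C r * f) = r * functional n t f := by
  rw [C_mul', map_smul, smul_eq_mul]

lemma functional_prod (n : ℕ) (t : ℕ → ℕ → ℚ) (p q s : ℕ) :
    functional n t (a1 ^ p * a2' ^ q * a3' ^ s) =
      if p + q + 2 * s = n then t p s else 0 := by
  have h := monomial_eq_prod (Finsupp.equivFunOnFinite.symm ![p, q, s]) 1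
  simp only [Finsupp.equivFunOnFinite_symm_apply_apply, C_1, one_mul] at h
  simp only [Matrix.cons_val] at h
  have e := (basisMonomials (Fin 3) ℚ).constr_basis ℚ
    (fun d => if d 0 + d 1 + 2 * d 2 = n then t (d 0) (d 2) else 0)
    (Finsupp.equivFunOnFinite.symm ![p, q, s])
  rw [coe_basisMonomials] at e
  rw [← h, functional, e]
  simp

/-- The conditions for `functional n t` to vanish on `relIdeal c`. -/
structure RelCoeffs.Compatible (c : RelCoeffs) (n : ℕ) (t : ℕ → ℕ → ℚ) : Prop where
  rel₁ : ∀ p q s, p + q + 2 * s + 3 = n → t (p + 3) s = c.α * t (p + 1) (s + 1)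
  rel₂ : ∀ p q s, p + q + 2 * s + 3 = n →
    t (p + 2) s = c.β * t (p + 1) (s + 1) + c.γ * t p (s + 1)
  rel₃ : ∀ p q s, p + q + 2 * s + 3 = n →
    t (p + 1) s = c.δ * t (p + 1) (s + 1) + c.ε * t p (s + 1)
  rel₄ : ∀ p q s, p + q + 2 * s + 4 = n →
    t (p + 2) (s + 1) = c.κ * t p (s + 1) + c.μ * t p (s + 2)

lemma functional_eq_zero {c : RelCoeffs} {n : ℕ} {t : ℕ → ℕ → ℚ} (h : c.Compatible n t)
    {f : R3} (hf : f ∈ relIdeal c) : functional n t f = 0 := by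
  have reduce : ∀ r : R3,
      (∀ p q s, functional n t (a1 ^ p * a2' ^ q * a3' ^ s * r) = 0) →
      ∀ a, functional n t (a * r) = 0 := by
    intro r hr a
    induction a using MvPolynomial.induction_on' with
    | monomial d u => rw [monomial_eq_prod, mul_assoc, functional_C_mul, hr, mul_zero]
    | add p q hp hq => rw [add_mul, map_add, hp, hq, add_zero]
  have key : ∀ a, functional n t (a * f) = 0 := by
    refine Submodule.span_induction ?_ (by simp) ?_ ?_ hf
    · simp only [Set.mem_insert_iff, Set.mem_singleton_iff]
      rintro r (rfl | rfl | rfl | rfl) <;> refine reduce _ fun p q s => ?_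
      · rw [show a1 ^ p * a2' ^ q * a3' ^ s * (a1 ^ 3 - C c.α * (a1 * a3')) =
            a1 ^ (p + 3) * a2' ^ q * a3' ^ s
              - C c.α * (a1 ^ (p + 1) * a2' ^ q * a3' ^ (s + 1)) by ring]
        simp only [map_sub, functional_C_mul, functional_prod]
        by_cases hw : p + q + 2 * s + 3 = n
        · rw [if_pos (by omega), if_pos (by omega), h.rel₁ p q s hw, sub_self]
        · rw [if_neg (by omega), if_neg (by omega)]
          ring
      · rw [show a1 ^ p * a2' ^ q * a3' ^ s *
              (a1 ^ 2 * a2' - C c.β * (a1 * a3') - C c.γ * (a2' * a3')) =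
            a1 ^ (p + 2) * a2' ^ (q + 1) * a3' ^ s
              - C c.β * (a1 ^ (p + 1) * a2' ^ q * a3' ^ (s + 1))
              - C c.γ * (a1 ^ p * a2' ^ (q + 1) * a3' ^ (s + 1)) by ring]
        simp only [map_sub, functional_C_mul, functional_prod]
        by_cases hw : p + q + 2 * s + 3 = n
        · rw [if_pos (by omega), if_pos (by omega), if_pos (by omega), h.rel₂ p q s hw]
          ring
        · rw [if_neg (by omega), if_neg (by omega), if_neg (by omega)]
          ring
      · rw [show a1 ^ p * a2' ^ q * a3' ^ s *
              (a1 * a2' ^ 2 - C c.δ * (a1 * a3') - C c.ε * (a2' * a3')) =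
            a1 ^ (p + 1) * a2' ^ (q + 2) * a3' ^ s
              - C c.δ * (a1 ^ (p + 1) * a2' ^ q * a3' ^ (s + 1))
              - C c.ε * (a1 ^ p * a2' ^ (q + 1) * a3' ^ (s + 1)) by ring]
        simp only [map_sub, functional_C_mul, functional_prod]
        by_cases hw : p + q + 2 * s + 3 = n
        · rw [if_pos (by omega), if_pos (by omega), if_pos (by omega), h.rel₃ p q s hw]
          ring
        · rw [if_neg (by omega), if_neg (by omega), if_neg (by omega)]
          ring
      · rw [show a1 ^ p * a2' ^ q * a3' ^ s *
              (a1 ^ 2 * a3' - C c.κ * (a2' ^ 2 * a3') - C c.μ * a3' ^ 2) =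
            a1 ^ (p + 2) * a2' ^ q * a3' ^ (s + 1)
              - C c.κ * (a1 ^ p * a2' ^ (q + 2) * a3' ^ (s + 1))
              - C c.μ * (a1 ^ p * a2' ^ q * a3' ^ (s + 2)) by ring]
        simp only [map_sub, functional_C_mul, functional_prod]
        by_cases hw : p + q + 2 * s + 4 = n
        · rw [if_pos (by omega), if_pos (by omega), if_pos (by omega), h.rel₄ p q s hw]
          ring
        · rw [if_neg (by omega), if_neg (by omega), if_neg (by omega)]
          ring
    · intro x y _ _ hx hy a
      rw [mul_add, map_add, hx, hy, add_zero]
    · intro b x _ hx a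
      rw [smul_eq_mul, ← mul_assoc, hx]
  simpa using key 1

lemma weight_wt (d : Fin 3 →₀ ℕ) : Finsupp.weight wt d = d 0 + d 1 + 2 * d 2 := by
  rw [Finsupp.weight_apply, Finsupp.sum_fintype _ _ (by simp), Fin.sum_univ_three]
  simp [wt, mul_comm]

/-- Monomials spanning a graded component, together with dual functionals vanishing on the
ideal, compute the dimension of the component. -/
lemma finrank_component {c : RelCoeffs} {n m : ℕ} (b : Fin m → ℕ × ℕ × ℕ)
    (hb : ∀ k, (b k).1 + (b k).2.1 + 2 * (b k).2.2 = n)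
    (t : Fin m → ℕ → ℕ → ℚ) (ht : ∀ j, c.Compatible n (t j))
    (hdual : ∀ j k, t j (b k).1 (b k).2.2 = if j = k then 1 else 0)
    (hspan : ∀ p q s, p + q + 2 * s = n →
      Ideal.Quotient.mk (relIdeal c) (a1 ^ p * a2' ^ q * a3' ^ s) ∈
        Submodule.span ℚ (Set.range fun k => Ideal.Quotient.mk (relIdeal c)
          (a1 ^ (b k).1 * a2' ^ (b k).2.1 * a3' ^ (b k).2.2))) :
    Module.finrank ℚ (component (relIdeal c) n) = m := by
  set v : Fin m → R3 ⧸ relIdeal c := fun k => Ideal.Quotient.mk (relIdeal c)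
    (a1 ^ (b k).1 * a2' ^ (b k).2.1 * a3' ^ (b k).2.2) with hv
  have hcomp : component (relIdeal c) n = Submodule.span ℚ (Set.range v) := by
    apply le_antisymm
    · rw [component, weightedHomogeneousSubmodule_eq_finsupp_supported,
        AddMonoidAlgebra.supported_eq_span_single, Submodule.map_span, Submodule.span_le]
      rintro _ ⟨_, ⟨d, hd, rfl⟩, rfl⟩
      have hd' : d 0 + d 1 + 2 * d 2 = n := by
        rw [← weight_wt]
        exact hd
      have h := hspan _ _ _ hd'
      have e := monomial_eq_prod d 1
      rw [C_1, one_mul] at e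
      rw [← e] at h
      exact h
    · rw [Submodule.span_le]
      rintro _ ⟨k, rfl⟩
      refine ⟨a1 ^ (b k).1 * a2' ^ (b k).2.1 * a3' ^ (b k).2.2, ?_, rfl⟩
      have h := ((isWeightedHomogeneous_X ℚ wt 0).pow (b k).1).mul
        ((isWeightedHomogeneous_X ℚ wt 1).pow (b k).2.1) |>.mul
        ((isWeightedHomogeneous_X ℚ wt 2).pow (b k).2.2)
      have e : (b k).1 • wt 0 + (b k).2.1 • wt 1 + (b k).2.2 • wt 2 = n := by
        rw [← hb k]
        simp [wt, mul_comm]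
      rw [e] at h
      exact h
  have hli : LinearIndependent ℚ v := by
    rw [Fintype.linearIndependent_iff]
    intro w hw j
    have hmem : ∑ k, C (w k) * (a1 ^ (b k).1 * a2' ^ (b k).2.1 * a3' ^ (b k).2.2) ∈
        relIdeal c := by
      rw [← Ideal.Quotient.eq_zero_iff_mem, ← hw, map_sum]
      refine Finset.sum_congr rfl fun k _ => ?_
      rw [C_mul']
      rfl
    have h := functional_eq_zero (ht j) hmem
    simpa [functional_C_mul, functional_prod, hb, hdual] using h
  rw [hcomp, finrank_span_eq_card hli, Fintype.card_fin]

lemma compatible_a2_pow (c : RelCoeffs) (n : ℕ) :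
    c.Compatible n fun p s => if p = 0 ∧ s = 0 then 1 else 0 := by
  constructor <;> intros <;> simp

lemma compatible_of_lt_three (c : RelCoeffs) {n : ℕ} (hn : n < 3) (t : ℕ → ℕ → ℚ) :
    c.Compatible n t := by
  constructor <;> intros <;> omega

lemma finrank_component_one (c : RelCoeffs) :
    Module.finrank ℚ (component (relIdeal c) 1) = 2 := by
  refine finrank_component ![(1, 0, 0), (0, 1, 0)] (by simp [Fin.forall_fin_two])
    ![fun p _ => if p = 1 then 1 else 0, fun p _ => if p = 0 then 1 else 0]
    (fun _ => compatible_of_lt_three c (by norm_num) _) (by simp [Fin.forall_fin_two]) ?_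
  intro p q s h
  apply Submodule.subset_span
  rcases (by omega : (p = 1 ∧ q = 0 ∧ s = 0) ∨ (p = 0 ∧ q = 1 ∧ s = 0)) with
    ⟨rfl, rfl, rfl⟩ | ⟨rfl, rfl, rfl⟩
  · exact ⟨0, rfl⟩
  · exact ⟨1, rfl⟩

lemma finrank_component_two (c : RelCoeffs) :
    Module.finrank ℚ (component (relIdeal c) 2) = 4 := by
  refine finrank_component ![(2, 0, 0), (1, 1, 0), (0, 2, 0), (0, 0, 1)]
    (by simp [Fin.forall_fin_succ])
    ![fun p _ => if p = 2 then 1 else 0, fun p _ => if p = 1 then 1 else 0,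
      fun p s => if p = 0 ∧ s = 0 then 1 else 0, fun _ s => if s = 1 then 1 else 0]
    (fun _ => compatible_of_lt_three c (by norm_num) _) (by simp [Fin.forall_fin_succ]) ?_
  intro p q s h
  apply Submodule.subset_span
  rcases (by omega : (p = 2 ∧ q = 0 ∧ s = 0) ∨ (p = 1 ∧ q = 1 ∧ s = 0) ∨
      (p = 0 ∧ q = 2 ∧ s = 0) ∨ (p = 0 ∧ q = 0 ∧ s = 1)) with
    ⟨rfl, rfl, rfl⟩ | ⟨rfl, rfl, rfl⟩ | ⟨rfl, rfl, rfl⟩ | ⟨rfl, rfl, rfl⟩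
  · exact ⟨0, rfl⟩
  · exact ⟨1, rfl⟩
  · exact ⟨2, rfl⟩
  · exact ⟨3, rfl⟩

section Relations

variable {A : Type*} [CommRing A] [Algebra ℚ A] {c : RelCoeffs} {k : ℚ} {x y z : A}

/-- The elements `x, y, z` satisfy the relations with coefficients `c`. -/
structure RelCoeffs.Holds (c : RelCoeffs) (x y z : A) : Prop where
  rel₁ : x ^ 3 = c.α • (x * z)
  rel₂ : x ^ 2 * y = c.β • (x * z) + c.γ • (y * z)
  rel₃ : x * y ^ 2 = c.δ • (x * z) + c.ε • (y * z)
  rel₄ : x ^ 2 * z = c.κ • (y ^ 2 * z) + c.μ • z ^ 2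

lemma RelCoeffs.holds_mk (c : RelCoeffs) :
    c.Holds (Ideal.Quotient.mk (relIdeal c) a1) (Ideal.Quotient.mk (relIdeal c) a2')
      (Ideal.Quotient.mk (relIdeal c) a3') := by
  have smul_mk (r : ℚ) (f : R3) : r • Ideal.Quotient.mk (relIdeal c) f =
      Ideal.Quotient.mk (relIdeal c) (C r * f) := by
    rw [C_mul']
    rfl
  constructor <;>
    simp only [← map_mul, ← map_pow, smul_mk, ← map_add] <;>
    refine Ideal.Quotient.eq.mpr ?_ <;>
    exact Ideal.subset_span (by simp [sub_sub])

lemma RelCoeffs.Holds.xyz_eq (h : c.Holds x y z) (hc : c.Nondegenerate k) :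
    x * y * z = k • (x ^ 2 * z) := by
  have e : (c.α - c.γ) • (x * y * z) = (c.α - c.γ) • k • (x ^ 2 * z) := by
    rw [smul_smul, mul_comm _ k, ← hc.β_eq]
    have h1 := h.rel₁
    have h2 := h.rel₂
    simp only [Algebra.smul_def, map_sub] at *
    linear_combination x * h2 - y * h1
  exact smul_right_injective A hc.sub_ne e

lemma RelCoeffs.Holds.yyz_eq (h : c.Holds x y z) (hc : c.Nondegenerate k) :
    y ^ 2 * z = ((c.δ + c.ε * k - c.β * k) / c.γ) • (x ^ 2 * z) := by
  have e : c.γ • (y ^ 2 * z) = (c.δ + c.ε * k - c.β * k) • (x ^ 2 * z) := by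
    have h0 := h.xyz_eq hc
    have h2 := h.rel₂
    have h3 := h.rel₃
    simp only [Algebra.smul_def, map_sub, map_add, map_mul] at *
    linear_combination x * h3 - y * h2 +
      (algebraMap ℚ A c.ε - algebraMap ℚ A c.β) * h0
  rw [div_eq_inv_mul, mul_smul, ← e, inv_smul_smul₀ hc.γ_ne]

lemma RelCoeffs.Holds.zz_eq (h : c.Holds x y z) (hc : c.Nondegenerate k) :
    z ^ 2 = ((1 - c.κ * ((c.δ + c.ε * k - c.β * k) / c.γ)) / c.μ) • (x ^ 2 * z) := by
  have e : c.μ • z ^ 2 = (1 - c.κ * ((c.δ + c.ε * k - c.β * k) / c.γ)) • (x ^ 2 * z) := by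
    rw [sub_smul, one_smul, mul_smul, ← h.yyz_eq hc, eq_sub_iff_add_eq, add_comm]
    exact h.rel₄.symm
  rw [div_eq_inv_mul, mul_smul, ← e, inv_smul_smul₀ hc.μ_ne]

/-- In degree four everything is a combination of `y⁴` and `x²z`. -/
lemma RelCoeffs.Holds.mem_of_quartic (hr : c.Holds x y z) (hc : c.Nondegenerate k)
    {S : Submodule ℚ A} (hy : y ^ 4 ∈ S) (hX : x ^ 2 * z ∈ S) {p q s : ℕ}
    (h : p + q + 2 * s = 4) : x ^ p * y ^ q * z ^ s ∈ S := by
  have hY : x * y * z ∈ S := hr.xyz_eq hc ▸ S.smul_mem _ hX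
  have hZ : y ^ 2 * z ∈ S := hr.yyz_eq hc ▸ S.smul_mem _ hX
  have hW : z ^ 2 ∈ S := hr.zz_eq hc ▸ S.smul_mem _ hX
  rcases (by omega : s = 0 ∨ s = 1 ∨ s = 2) with rfl | rfl | rfl
  · rcases (by omega : (p = 4 ∧ q = 0) ∨ (p = 3 ∧ q = 1) ∨ (p = 2 ∧ q = 2) ∨
      (p = 1 ∧ q = 3) ∨ (p = 0 ∧ q = 4)) with
      ⟨rfl, rfl⟩ | ⟨rfl, rfl⟩ | ⟨rfl, rfl⟩ | ⟨rfl, rfl⟩ | ⟨rfl, rfl⟩ <;>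
      simp only [pow_zero, pow_one, one_mul, mul_one]
    · rw [show x ^ 4 = x * x ^ 3 by ring, hr.rel₁, mul_smul_comm, ← mul_assoc, ← pow_two]
      exact S.smul_mem _ hX
    · rw [show x ^ 3 * y = y * x ^ 3 by ring, hr.rel₁, mul_smul_comm,
        show y * (x * z) = x * y * z by ring]
      exact S.smul_mem _ hY
    · rw [show x ^ 2 * y ^ 2 = x * (x * y ^ 2) by ring, hr.rel₃, mul_add, mul_smul_comm,
        mul_smul_comm, ← mul_assoc, ← mul_assoc, ← pow_two]
      exact S.add_mem (S.smul_mem _ hX) (S.smul_mem _ hY)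
    · rw [show x * y ^ 3 = y * (x * y ^ 2) by ring, hr.rel₃, mul_add, mul_smul_comm,
        mul_smul_comm, ← mul_assoc, ← mul_assoc, ← pow_two, mul_comm y x]
      exact S.add_mem (S.smul_mem _ hY) (S.smul_mem _ hZ)
    · exact hy
  · rcases (by omega : (p = 2 ∧ q = 0) ∨ (p = 1 ∧ q = 1) ∨ (p = 0 ∧ q = 2)) with
      ⟨rfl, rfl⟩ | ⟨rfl, rfl⟩ | ⟨rfl, rfl⟩ <;>
      simp only [pow_zero, pow_one, one_mul, mul_one]
    · exact hX
    · exact hY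
    · exact hZ
  · obtain ⟨rfl, rfl⟩ : p = 0 ∧ q = 0 := by omega
    simpa using hW

lemma RelCoeffs.Holds.yzz_eq (h : c.Holds x y z) (hc : c.Nondegenerate k) :
    y * z ^ 2 = k • (x * z ^ 2) := by
  have e : c.γ • (y * z ^ 2) = c.γ • k • (x * z ^ 2) := by
    have h0 := h.xyz_eq hc
    have h1 := h.rel₁
    have h2 := h.rel₂
    have hβ := congrArg (algebraMap ℚ A) hc.β_eq
    simp only [Algebra.smul_def, map_sub, map_mul] at *
    linear_combination x * h0 - z * h2 + algebraMap ℚ A k * z * h1 - x * z ^ 2 * hβ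
  exact smul_right_injective A hc.γ_ne e

lemma RelCoeffs.Holds.xzz_eq_zero (h : c.Holds x y z) (hc : c.Nondegenerate k) :
    x * z ^ 2 = 0 := by
  refine (smul_eq_zero_iff_right hc.disc_ne).mp ?_
  have h0 := h.xyz_eq hc
  have h1 := h.rel₁
  have h3 := h.rel₃
  have h5 := h.yzz_eq hc
  simp only [Algebra.smul_def, map_sub, map_add, map_mul, map_pow] at *
  linear_combination (y + algebraMap ℚ A k * x) * h0 - z * h3 +
    algebraMap ℚ A k ^ 2 * z * h1 - algebraMap ℚ A c.ε * h5

lemma RelCoeffs.Holds.yzz_eq_zero (h : c.Holds x y z) (hc : c.Nondegenerate k) :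
    y * z ^ 2 = 0 := by
  rw [h.yzz_eq hc, h.xzz_eq_zero hc, smul_zero]

lemma RelCoeffs.Holds.eq_zero (h : c.Holds x y z) (hc : c.Nondegenerate k) {p q s : ℕ}
    (hw : 5 ≤ p + q + 2 * s) (hps : p ≠ 0 ∨ s ≠ 0) : x ^ p * y ^ q * z ^ s = 0 := by
  have hxz := h.xzz_eq_zero hc
  have hyz := h.yzz_eq_zero hc
  have h1 := h.rel₁
  have h2 := h.rel₂
  have h3 := h.rel₃
  have h4 := h.rel₄
  have hzz : z ^ 3 = 0 := by
    refine (smul_eq_zero_iff_right hc.μ_ne).mp ?_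
    simp only [Algebra.smul_def] at *
    linear_combination x * hxz - z * h4 - algebraMap ℚ A c.κ * y * hyz
  have hxxx : x ^ 3 * z = 0 := by
    simp only [Algebra.smul_def] at *
    linear_combination z * h1 + algebraMap ℚ A c.α * hxz
  have hxxy : x ^ 2 * y * z = 0 := by
    simp only [Algebra.smul_def] at *
    linear_combination z * h2 + algebraMap ℚ A c.β * hxz + algebraMap ℚ A c.γ * hyz
  have hxyy : x * y ^ 2 * z = 0 := by
    simp only [Algebra.smul_def] at *
    linear_combination z * h3 + algebraMap ℚ A c.δ * hxz + algebraMap ℚ A c.ε * hyz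
  have hyyy : y ^ 3 * z = 0 := by
    refine (smul_eq_zero_iff_right hc.κ_ne).mp ?_
    simp only [Algebra.smul_def] at *
    linear_combination hxxy - y * h4 - algebraMap ℚ A c.μ * hyz
  have h50 : x ^ 5 = 0 := by
    simp only [Algebra.smul_def] at *
    linear_combination x ^ 2 * h1 + algebraMap ℚ A c.α * hxxx
  have h41 : x ^ 4 * y = 0 := by
    simp only [Algebra.smul_def] at *
    linear_combination x * y * h1 + algebraMap ℚ A c.α * hxxy
  have h32 : x ^ 3 * y ^ 2 = 0 := by
    simp only [Algebra.smul_def] at *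
    linear_combination y ^ 2 * h1 + algebraMap ℚ A c.α * hxyy
  have h23 : x ^ 2 * y ^ 3 = 0 := by
    simp only [Algebra.smul_def] at *
    linear_combination y ^ 2 * h2 + algebraMap ℚ A c.β * hxyy + algebraMap ℚ A c.γ * hyyy
  have h14 : x * y ^ 4 = 0 := by
    simp only [Algebra.smul_def] at *
    linear_combination y ^ 2 * h3 + algebraMap ℚ A c.δ * hxyy + algebraMap ℚ A c.ε * hyyy
  have key : ∀ p' q' s', x ^ p' * y ^ q' * z ^ s' = 0 → p' ≤ p → q' ≤ q → s' ≤ s →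
      x ^ p * y ^ q * z ^ s = 0 := fun p' q' s' h0 hp hq hs =>
    zero_dvd_iff.mp (h0 ▸ mul_dvd_mul (mul_dvd_mul (pow_dvd_pow x hp) (pow_dvd_pow y hq))
      (pow_dvd_pow z hs))
  rcases (by omega : 3 ≤ s ∨ s = 2 ∨ s = 1 ∨ s = 0) with hs | rfl | rfl | rfl
  · exact key 0 0 3 (by simpa using hzz) (by omega) (by omega) hs
  · rcases (by omega : 1 ≤ p ∨ 1 ≤ q) with hp | hq
    · exact key 1 0 2 (by simpa using hxz) hp (by omega) le_rfl
    · exact key 0 1 2 (by simpa using hyz) (by omega) hq le_rfl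
  · rcases (by omega : 3 ≤ p ∨ (2 ≤ p ∧ 1 ≤ q) ∨ (1 ≤ p ∧ 2 ≤ q) ∨ 3 ≤ q) with
      hp | ⟨hp, hq⟩ | ⟨hp, hq⟩ | hq
    · exact key 3 0 1 (by simpa using hxxx) hp (by omega) le_rfl
    · exact key 2 1 1 (by simpa using hxxy) hp hq le_rfl
    · exact key 1 2 1 (by simpa using hxyy) hp hq le_rfl
    · exact key 0 3 1 (by simpa using hyyy) (by omega) hq le_rfl
  · rcases (by omega : 5 ≤ p ∨ (4 ≤ p ∧ 1 ≤ q) ∨ (3 ≤ p ∧ 2 ≤ q) ∨ (2 ≤ p ∧ 3 ≤ q) ∨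
      (1 ≤ p ∧ 4 ≤ q)) with hp | ⟨hp, hq⟩ | ⟨hp, hq⟩ | ⟨hp, hq⟩ | ⟨hp, hq⟩
    · exact key 5 0 0 (by simpa using h50) hp (by omega) le_rfl
    · exact key 4 1 0 (by simpa using h41) hp hq le_rfl
    · exact key 3 2 0 (by simpa using h32) hp hq le_rfl
    · exact key 2 3 0 (by simpa using h23) hp hq le_rfl
    · exact key 1 4 0 (by simpa using h14) hp hq le_rfl

end Relations

lemma finrank_component_three (c : RelCoeffs) :
    Module.finrank ℚ (component (relIdeal c) 3) = 3 := by
  refine finrank_component ![(0, 3, 0), (1, 0, 1), (0, 1, 1)] (by simp [Fin.forall_fin_succ])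
    ![fun p s => if p = 0 ∧ s = 0 then 1 else 0,
      fun p s => if s = 1 then (if p = 1 then 1 else 0) else
        if p = 3 then c.α else if p = 2 then c.β else if p = 1 then c.δ else 0,
      fun p s => if s = 1 then (if p = 0 then 1 else 0) else
        if p = 2 then c.γ else if p = 1 then c.ε else 0]
    ?_ (by simp [Fin.forall_fin_succ]) ?_
  · simp only [Fin.forall_fin_succ]
    refine ⟨compatible_a2_pow c 3, ?_, ?_, by simp⟩ <;> constructor <;> intro p q s h <;>
      first
      | omega
      | obtain ⟨rfl, rfl, rfl⟩ : p = 0 ∧ q = 0 ∧ s = 0 := by omega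
        simp
  intro p q s h
  have hc := c.holds_mk
  simp only [map_mul, map_pow]
  set x := Ideal.Quotient.mk (relIdeal c) a1
  set y := Ideal.Quotient.mk (relIdeal c) a2'
  set z := Ideal.Quotient.mk (relIdeal c) a3'
  set S : Submodule ℚ (R3 ⧸ relIdeal c) := Submodule.span ℚ _
  have hy : y ^ 3 ∈ S := Submodule.subset_span ⟨0, by simp⟩
  have hxz : x * z ∈ S := Submodule.subset_span ⟨1, by simp⟩
  have hyz : y * z ∈ S := Submodule.subset_span ⟨2, by simp⟩
  rcases (by omega : (p = 3 ∧ q = 0 ∧ s = 0) ∨ (p = 2 ∧ q = 1 ∧ s = 0) ∨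
      (p = 1 ∧ q = 2 ∧ s = 0) ∨ (p = 0 ∧ q = 3 ∧ s = 0) ∨ (p = 1 ∧ q = 0 ∧ s = 1) ∨
      (p = 0 ∧ q = 1 ∧ s = 1)) with
    ⟨rfl, rfl, rfl⟩ | ⟨rfl, rfl, rfl⟩ | ⟨rfl, rfl, rfl⟩ | ⟨rfl, rfl, rfl⟩ | ⟨rfl, rfl, rfl⟩ |
    ⟨rfl, rfl, rfl⟩ <;> simp only [pow_zero, pow_one, one_mul, mul_one]
  · rw [hc.rel₁]
    exact S.smul_mem _ hxz
  · rw [hc.rel₂]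
    exact S.add_mem (S.smul_mem _ hxz) (S.smul_mem _ hyz)
  · rw [hc.rel₃]
    exact S.add_mem (S.smul_mem _ hxz) (S.smul_mem _ hyz)
  · exact hy
  · exact hxz
  · exact hyz

/-- The values on monomials `a₁^p a₂′^(4 - p - 2s) a₃′^s` of the functional in degree four dual to
`a₁²a₃′`. -/
def quarticDual (c : RelCoeffs) (k : ℚ) (p s : ℕ) : ℚ :=
  let w := (c.δ + c.ε * k - c.β * k) / c.γ
  if s = 2 then (1 - c.κ * w) / c.μ
  else if s = 1 then (if p = 2 then 1 else if p = 1 then k else w)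
  else if p = 4 then c.α else if p = 3 then c.α * k else if p = 2 then c.δ + c.ε * k
  else if p = 1 then c.δ * k + c.ε * w else 0

lemma compatible_quarticDual {c : RelCoeffs} {k : ℚ} (hc : c.Nondegenerate k) :
    c.Compatible 4 (quarticDual c k) := by
  have hγ := hc.γ_ne
  have hμ := hc.μ_ne
  have hβ := hc.β_eq
  constructor <;> intro p q s h
  · rcases (by omega : (p = 1 ∧ q = 0 ∧ s = 0) ∨ (p = 0 ∧ q = 1 ∧ s = 0)) with
      ⟨rfl, rfl, rfl⟩ | ⟨rfl, rfl, rfl⟩ <;> simp [quarticDual]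
  · rcases (by omega : (p = 1 ∧ q = 0 ∧ s = 0) ∨ (p = 0 ∧ q = 1 ∧ s = 0)) with
      ⟨rfl, rfl, rfl⟩ | ⟨rfl, rfl, rfl⟩ <;> simp [quarticDual]
    · linear_combination -hβ
    · field_simp
      ring
  · rcases (by omega : (p = 1 ∧ q = 0 ∧ s = 0) ∨ (p = 0 ∧ q = 1 ∧ s = 0)) with
      ⟨rfl, rfl, rfl⟩ | ⟨rfl, rfl, rfl⟩ <;> simp [quarticDual]
  · obtain ⟨rfl, rfl, rfl⟩ : p = 0 ∧ q = 0 ∧ s = 0 := by omega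
    simp [quarticDual]
    field_simp
    ring

lemma finrank_component_four {c : RelCoeffs} {k : ℚ} (hc : c.Nondegenerate k) :
    Module.finrank ℚ (component (relIdeal c) 4) = 2 := by
  refine finrank_component ![(0, 4, 0), (2, 0, 1)] (by simp [Fin.forall_fin_two])
    ![fun p s => if p = 0 ∧ s = 0 then 1 else 0, quarticDual c k] ?_
    (by simp [Fin.forall_fin_two, quarticDual]) ?_
  · simp only [Fin.forall_fin_two]
    exact ⟨compatible_a2_pow c 4, compatible_quarticDual hc⟩
  intro p q s h
  simp only [map_mul, map_pow]
  refine c.holds_mk.mem_of_quartic hc (Submodule.subset_span ?_) (Submodule.subset_span ?_) h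
  · exact ⟨0, by simp⟩
  · exact ⟨1, by simp⟩

lemma finrank_component_of_five_le {c : RelCoeffs} {k : ℚ} (hc : c.Nondegenerate k) {n : ℕ}
    (hn : 5 ≤ n) : Module.finrank ℚ (component (relIdeal c) n) = 1 := by
  refine finrank_component ![(0, n, 0)] (by simp)
    ![fun p s => if p = 0 ∧ s = 0 then 1 else 0] ?_ (by simp) ?_
  · intro j
    fin_cases j
    exact compatible_a2_pow c n
  intro p q s h
  by_cases hps : p = 0 ∧ s = 0
  · obtain ⟨rfl, rfl⟩ := hps
    obtain rfl : q = n := by omega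
    exact Submodule.subset_span ⟨0, rfl⟩
  · simp only [map_mul, map_pow]
    rw [c.holds_mk.eq_zero hc (by omega) (by omega)]
    exact Submodule.zero_mem _

/-- Dimensions of the stable Chow groups of the degree-4 Hurwitz space:
for `i ≥ 1` and `g > 4i + 12`, `dim_ℚ Q(g)_i` is `2, 4, 3, 2` for `i = 1, 2, 3, 4`
and `1` for `i ≥ 5`. -/
theorem dim_QComp (i : ℕ) (hi : 1 ≤ i) (g : ℤ) (hg : g > 4 * (i : ℤ) + 12) :
    Module.finrank ℚ (QComp g i) =
      if i = 1 then 2 else if i = 2 then 4 else if i = 3 then 3 else if i = 4 then 2 else 1 := by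
  have hg' : (17 : ℚ) ≤ g := by
    have h : (17 : ℤ) ≤ g := by omega
    exact_mod_cast h
  change Module.finrank ℚ (component (Ig g) i) = _
  rw [Ig_eq_relIdeal g hg']
  have hc := hurwitzCoeffs_nondegenerate hg'
  rcases (by omega : i = 1 ∨ i = 2 ∨ i = 3 ∨ i = 4 ∨ 5 ≤ i) with rfl | rfl | rfl | rfl | h5
  · exact finrank_component_one _
  · exact finrank_component_two _
  · exact finrank_component_three _
  · exact finrank_component_four hc
  · rw [finrank_component_of_five_le hc h5]
    simp [show i ≠ 1 by omega, show i ≠ 2 by omega, show i ≠ 3 by omega, show i ≠ 4 by omega]
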